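/- Let T be a closed densely defined linear operator from H₁ to H₂ with closed range, let T† be its Moore–Penrose inverse, and let S : H₁ → H₂ be a bounded linear operator satisfying (1) ‖T† ∘ S‖ < 1, (2) T(T†(Su)) = Su for all u ∈ H₁, and (3) S(T†(Tx)) = Sx for all x ∈ D(T). Then (a) R(T + S) is closed, and (b) the bounded operator (I + T† S)⁻¹ ∘ T† is the Moore–Penrose inverse of T + S (it satisfies the three defining properties with respect to T + S), and moreover (I + T† S)⁻¹ T† = T† (I + S T†)⁻¹. -/

import Mathlib

/-- The null space `N(T)` of a partially defined operator `T`, as a submodule of the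
ambient space. -/
def pmKer {H₁ H₂ : Type*} [NormedAddCommGroup H₁] [InnerProductSpace ℂ H₁]
    [NormedAddCommGroup H₂] [InnerProductSpace ℂ H₂] (T : H₁ →ₗ.[ℂ] H₂) : Submodule ℂ H₁ :=
  (LinearMap.ker T.toFun).map T.domain.subtype

/-- The range `R(T)` of a partially defined operator `T`. -/
def pmRan {H₁ H₂ : Type*} [NormedAddCommGroup H₁] [InnerProductSpace ℂ H₁]
    [NormedAddCommGroup H₂] [InnerProductSpace ℂ H₂] (T : H₁ →ₗ.[ℂ] H₂) : Submodule ℂ H₂ :=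
  LinearMap.range T.toFun

/-- `Td` is the Moore–Penrose inverse of the closed range, densely defined operator `T`:
it is a bounded operator with range contained in the carrier `C(T) = D(T) ∩ N(T)^⊥`,
`T (T† y) = P_{R(T)} y` for all `y`, `T† (T x) = P_{N(T)^⊥} x` for all `x ∈ D(T)`,
and `N(T†) = R(T)^⊥` (the projection identities are expressed via the characteristic
orthogonality properties of orthogonal projections onto closed subspaces). -/
structure IsMPOf {H₁ H₂ : Type*} [NormedAddCommGroup H₁] [InnerProductSpace ℂ H₁]
    [NormedAddCommGroup H₂] [InnerProductSpace ℂ H₂]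
    (T : H₁ →ₗ.[ℂ] H₂) (Td : H₂ →L[ℂ] H₁) : Prop where
  mem_dom : ∀ y : H₂, Td y ∈ T.domain
  mem_carrier : ∀ y : H₂, Td y ∈ (pmKer T)ᗮ
  proj_ran : ∀ y : H₂, y - T ⟨Td y, mem_dom y⟩ ∈ (pmRan T)ᗮ
  proj_ker : ∀ x : T.domain, (x : H₁) - Td (T x) ∈ pmKer T
  ker_eq : ∀ y : H₂, Td y = 0 ↔ y ∈ (pmRan T)ᗮ

/-- The operator `T + S` with domain `D(T)`, where `T` is partially defined and
`S` is bounded. -/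
def addPM {H₁ H₂ : Type*} [NormedAddCommGroup H₁] [InnerProductSpace ℂ H₁]
    [NormedAddCommGroup H₂] [InnerProductSpace ℂ H₂]
    (T : H₁ →ₗ.[ℂ] H₂) (S : H₁ →L[ℂ] H₂) : H₁ →ₗ.[ℂ] H₂ :=
  ⟨T.domain, T.toFun + (S : H₁ →ₗ[ℂ] H₂).comp T.domain.subtype⟩

section

variable {H₁ H₂ : Type*} [NormedAddCommGroup H₁] [InnerProductSpace ℂ H₁]
  [NormedAddCommGroup H₂] [InnerProductSpace ℂ H₂]

theorem mem_pmKer_iff {T : H₁ →ₗ.[ℂ] H₂} {x : H₁} :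
    x ∈ pmKer T ↔ ∃ h : x ∈ T.domain, T ⟨x, h⟩ = 0 := by
  simp only [pmKer, Submodule.mem_map, LinearMap.mem_ker]
  constructor
  · rintro ⟨y, hy, rfl⟩
    exact ⟨y.2, hy⟩
  · rintro ⟨h, hx⟩
    exact ⟨⟨x, h⟩, hx, rfl⟩

theorem mem_pmRan_iff {T : H₁ →ₗ.[ℂ] H₂} {y : H₂} :
    y ∈ pmRan T ↔ ∃ x, ∃ h : x ∈ T.domain, T ⟨x, h⟩ = y := by
  simp only [pmRan, LinearMap.mem_range]
  constructor
  · rintro ⟨x, hx⟩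
    exact ⟨x, x.2, hx⟩
  · rintro ⟨x, h, hx⟩
    exact ⟨⟨x, h⟩, hx⟩

theorem addPM_apply (T : H₁ →ₗ.[ℂ] H₂) (S : H₁ →L[ℂ] H₂) {x : H₁} (h : x ∈ T.domain) :
    addPM T S ⟨x, h⟩ = T ⟨x, h⟩ + S x :=
  rfl

/-- `(T + S) x = T ((1 + T† S) x)` when `T T† S = S`. -/
theorem addPM_eq_apply_add {T : H₁ →ₗ.[ℂ] H₂} {Td : H₂ →L[ℂ] H₁} (hMP : IsMPOf T Td)
    {S : H₁ →L[ℂ] H₂} (hS1 : ∀ u : H₁, T ⟨Td (S u), hMP.mem_dom (S u)⟩ = S u)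
    {x z : H₁} (hx : x ∈ T.domain) (hz : z ∈ T.domain) (hxz : x + Td (S x) = z) :
    addPM T S ⟨x, hx⟩ = T ⟨z, hz⟩ := by
  subst hxz
  have h : T (⟨x, hx⟩ + ⟨Td (S x), hMP.mem_dom _⟩) = _ := T.map_add _ _
  rw [hS1] at h
  exact h.symm

theorem apply_eq_zero_of_mem_pmKer {T : H₁ →ₗ.[ℂ] H₂} {Td : H₂ →L[ℂ] H₁} {S : H₁ →L[ℂ] H₂}
    (hS2 : ∀ x : T.domain, S (Td (T x)) = S (x : H₁)) {x : H₁} (hx : x ∈ pmKer T) :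
    S x = 0 := by
  obtain ⟨h, hx⟩ := mem_pmKer_iff.1 hx
  simpa [hx] using (hS2 ⟨x, h⟩).symm

/-- If `V` inverts `1 + T† S`, then `V` is `1` minus a map with values in the range of `T†`. -/
theorem inverse_apply_eq_sub {Td : H₂ →L[ℂ] H₁} {S : H₁ →L[ℂ] H₂} {V : H₁ →L[ℂ] H₁}
    (hV : ∀ x, V x + Td (S (V x)) = x) (x : H₁) : V x = x - Td (S (V x)) :=
  eq_sub_of_add_eq (hV x)

theorem inverse_mem_domain {T : H₁ →ₗ.[ℂ] H₂} {Td : H₂ →L[ℂ] H₁} (hMP : IsMPOf T Td)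
    {S : H₁ →L[ℂ] H₂} {V : H₁ →L[ℂ] H₁} (hV : ∀ x, V x + Td (S (V x)) = x)
    {x : H₁} (hx : x ∈ T.domain) : V x ∈ T.domain := by
  rw [inverse_apply_eq_sub hV]
  exact T.domain.sub_mem hx (hMP.mem_dom _)

theorem inverse_apply_of_mem_pmKer {T : H₁ →ₗ.[ℂ] H₂} {Td : H₂ →L[ℂ] H₁} {S : H₁ →L[ℂ] H₂}
    (hS2 : ∀ x : T.domain, S (Td (T x)) = S (x : H₁)) {V : H₁ →L[ℂ] H₁}
    (hV' : ∀ x, V (x + Td (S x)) = x) {x : H₁} (hx : x ∈ pmKer T) : V x = x := by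
  simpa [apply_eq_zero_of_mem_pmKer hS2 hx] using hV' x

theorem pmRan_addPM {T : H₁ →ₗ.[ℂ] H₂} {Td : H₂ →L[ℂ] H₁} (hMP : IsMPOf T Td)
    {S : H₁ →L[ℂ] H₂} (hS1 : ∀ u : H₁, T ⟨Td (S u), hMP.mem_dom (S u)⟩ = S u)
    {V : H₁ →L[ℂ] H₁} (hV : ∀ x, V x + Td (S (V x)) = x) :
    pmRan (addPM T S) = pmRan T := by
  ext y
  simp only [mem_pmRan_iff]
  constructor
  · rintro ⟨x, hx, rfl⟩
    exact ⟨_, T.domain.add_mem hx (hMP.mem_dom _), (addPM_eq_apply_add hMP hS1 hx _ rfl).symm⟩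
  · rintro ⟨x, hx, rfl⟩
    exact ⟨V x, inverse_mem_domain hMP hV hx, addPM_eq_apply_add hMP hS1 _ hx (hV x)⟩

theorem pmKer_addPM {T : H₁ →ₗ.[ℂ] H₂} {Td : H₂ →L[ℂ] H₁} (hMP : IsMPOf T Td)
    {S : H₁ →L[ℂ] H₂} (hS1 : ∀ u : H₁, T ⟨Td (S u), hMP.mem_dom (S u)⟩ = S u)
    (hS2 : ∀ x : T.domain, S (Td (T x)) = S (x : H₁))
    {V : H₁ →L[ℂ] H₁} (hV' : ∀ x, V (x + Td (S x)) = x) :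
    pmKer (addPM T S) = pmKer T := by
  ext x
  constructor
  · intro hx
    obtain ⟨h, hx⟩ := mem_pmKer_iff.1 hx
    have hz := T.domain.add_mem h (hMP.mem_dom (S x))
    rw [addPM_eq_apply_add hMP hS1 h hz rfl] at hx
    have hk : x + Td (S x) ∈ pmKer T := mem_pmKer_iff.2 ⟨hz, hx⟩
    have hfix := inverse_apply_of_mem_pmKer hS2 hV' hk
    rw [hV'] at hfix
    rwa [hfix]
  · intro hx
    obtain ⟨h, h0⟩ := mem_pmKer_iff.1 hx
    refine mem_pmKer_iff.2 ⟨h, ?_⟩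
    rw [addPM_apply, h0, apply_eq_zero_of_mem_pmKer hS2 hx, add_zero]

theorem isMPOf_addPM {T : H₁ →ₗ.[ℂ] H₂} {Td : H₂ →L[ℂ] H₁} (hMP : IsMPOf T Td)
    {S : H₁ →L[ℂ] H₂} (hS1 : ∀ u : H₁, T ⟨Td (S u), hMP.mem_dom (S u)⟩ = S u)
    (hS2 : ∀ x : T.domain, S (Td (T x)) = S (x : H₁))
    {V : H₁ →L[ℂ] H₁} (hV : ∀ x, V x + Td (S (V x)) = x) (hV' : ∀ x, V (x + Td (S x)) = x) :
    IsMPOf (addPM T S) (V.comp Td) where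
  mem_dom y := inverse_mem_domain hMP hV (hMP.mem_dom y)
  mem_carrier y := by
    rw [pmKer_addPM hMP hS1 hS2 hV', ContinuousLinearMap.comp_apply, inverse_apply_eq_sub hV]
    exact Submodule.sub_mem _ (hMP.mem_carrier _) (hMP.mem_carrier _)
  proj_ran y := by
    rw [pmRan_addPM hMP hS1 hV]
    have h := addPM_eq_apply_add hMP hS1 (inverse_mem_domain hMP hV (hMP.mem_dom y))
      (hMP.mem_dom y) (hV (Td y))
    exact h ▸ hMP.proj_ran y
  proj_ker := by
    rintro ⟨x, hx⟩
    have hz := T.domain.add_mem hx (hMP.mem_dom (S x))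
    have hk := hMP.proj_ker ⟨_, hz⟩
    have hfix := inverse_apply_of_mem_pmKer hS2 hV' hk
    rw [map_sub, hV'] at hfix
    rw [pmKer_addPM hMP hS1 hS2 hV', addPM_eq_apply_add hMP hS1 hx hz rfl,
      ContinuousLinearMap.comp_apply, hfix]
    exact hk
  ker_eq y := by
    rw [pmRan_addPM hMP hS1 hV, ← hMP.ker_eq, ContinuousLinearMap.comp_apply]
    refine ⟨fun h => ?_, fun h => by rw [h, map_zero]⟩
    simpa [h] using (hV (Td y)).symm

end

/-- Theorem 3.5: if `‖T† S‖ < 1`, `T T† S = S` and `S T† T = S|_{D(T)}`, then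
`R(T + S)` is closed and `(T + S)† = (I + T† S)⁻¹ T† = T† (I + S T†)⁻¹`. -/
theorem stmt5 {H₁ H₂ : Type*} [NormedAddCommGroup H₁] [InnerProductSpace ℂ H₁] [CompleteSpace H₁]
    [NormedAddCommGroup H₂] [InnerProductSpace ℂ H₂] [CompleteSpace H₂]
    (T : H₁ →ₗ.[ℂ] H₂) (hTclosed : T.IsClosed) (hTdense : Dense (T.domain : Set H₁))
    (hTran : IsClosed (pmRan T : Set H₂))
    (Td : H₂ →L[ℂ] H₁) (hMP : IsMPOf T Td) (S : H₁ →L[ℂ] H₂)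
    (hnorm : ‖Td.comp S‖ < 1)
    (hS1 : ∀ u : H₁, T ⟨Td (S u), hMP.mem_dom (S u)⟩ = S u)
    (hS2 : ∀ x : T.domain, S (Td (T x)) = S (x : H₁)) :
    IsClosed (pmRan (addPM T S) : Set H₂) ∧
      ∃ V : H₁ →L[ℂ] H₁, V.comp (1 + Td.comp S) = 1 ∧ (1 + Td.comp S).comp V = 1 ∧
        IsMPOf (addPM T S) (V.comp Td) ∧
        ∃ W : H₂ →L[ℂ] H₂, W.comp (1 + S.comp Td) = 1 ∧ (1 + S.comp Td).comp W = 1 ∧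
          V.comp Td = Td.comp W := by
  obtain ⟨V, hVl, hVr⟩ : ∃ V : H₁ →L[ℂ] H₁,
      V.comp (1 + Td.comp S) = 1 ∧ (1 + Td.comp S).comp V = 1 := by
    let u := Units.oneSub (-(Td.comp S)) (by rwa [norm_neg])
    have hu : (u : H₁ →L[ℂ] H₁) = 1 + Td.comp S := sub_neg_eq_add _ _
    exact ⟨↑u⁻¹, hu ▸ u.inv_mul, hu ▸ u.mul_inv⟩
  have hV : ∀ x, V x + Td (S (V x)) = x := fun x => DFunLike.congr_fun hVr x
  have hV' : ∀ x, V (x + Td (S x)) = x := fun x => DFunLike.congr_fun hVl x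
  refine ⟨by rwa [pmRan_addPM hMP hS1 hV], V, hVl, hVr, isMPOf_addPM hMP hS1 hS2 hV hV',
    1 - S.comp (V.comp Td), ?_, ?_, ?_⟩
  · ext y
    have h : S (V (Td y + Td (S (Td y)))) = S (Td y) := by rw [hV']
    change y + S (Td y) - S (V (Td (y + S (Td y)))) = y
    rw [map_add Td, h, add_sub_cancel_right]
  · ext y
    have h : S (V (Td y) + Td (S (V (Td y)))) = S (Td y) := by rw [hV]
    change y - S (V (Td y)) + S (Td (y - S (V (Td y)))) = y
    rw [map_sub, map_sub, ← h, map_add]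
    abel
  · ext y
    simpa using inverse_apply_eq_sub hV (Td y)
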